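/- Let λ ∈ ℝ and let f₁, f₂ : ℝ × Ω → ℝ be such that ℙ(f₁(x,ω) < f₂(x,ω) for all x ∈ ℝ) = 1, and assume that either (f₁ is a stationary lower solution and f₂ a stationary upper solution for the value λ) or (f₁ is a stationary upper solution and f₂ a stationary lower solution for the value λ). Then there exists f̄ ∈ S_st^λ such that for ℙ-a.e. ω, f̄(·,ω) ∈ S^λ(f₁(·,ω), f₂(·,ω), ω) and f̄(x,ω) = sup{ f(x) : f ∈ S^λ(f₁(·,ω), f₂(·,ω), ω) } for all x ∈ ℝ. -/

import Mathlib

open MeasureTheory Filter Set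

structure HJSetting {Ω : Type} [MeasurableSpace Ω] (P : Measure Ω) (τ : ℝ → Ω → Ω)
    (a : ℝ → Ω → ℝ) (H : ℝ → ℝ → Ω → ℝ) (G_L G_U : ℝ → ℝ) : Prop where
  prob : IsProbabilityMeasure P
  meas_tau : Measurable fun q : ℝ × Ω => τ q.1 q.2
  mp_tau : ∀ x, MeasurePreserving (τ x) P P
  tau_zero : ∀ ω, τ 0 ω = ω
  tau_add : ∀ x y ω, τ (x + y) ω = τ x (τ y ω)
  ergodic : ∀ A : Set Ω, MeasurableSet A → (∀ x, τ x ⁻¹' A = A) → P A = 0 ∨ P A = 1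
  meas_a : Measurable fun q : ℝ × Ω => a q.1 q.2
  a_pos : ∀ x ω, 0 < a x ω
  a_le_one : ∀ x ω, a x ω ≤ 1
  a_stat : ∀ x ω, a x ω = a 0 (τ x ω)
  a_sqrt_lip : ∃ κ > (0:ℝ), ∀ x ω, |Real.sqrt (a x ω) - Real.sqrt (a 0 ω)| ≤ κ * |x|
  meas_H : Measurable fun q : ℝ × ℝ × Ω => H q.1 q.2.1 q.2.2
  H_stat : ∀ p x ω, H p x ω = H p 0 (τ x ω)
  GL_cont : Continuous G_L
  GU_cont : Continuous G_U
  GL_even : ∀ p, G_L (-p) = G_L p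
  GU_even : ∀ p, G_U (-p) = G_U p
  GL_mono : MonotoneOn G_L (Ici 0)
  GU_mono : MonotoneOn G_U (Ici 0)
  GL_coercive : Tendsto G_L atTop atTop
  GU_coercive : Tendsto G_U atTop atTop
  H_lower : ∀ p ω, G_L p ≤ H p 0 ω
  H_upper : ∀ p ω, H p 0 ω ≤ G_U p
  H_lip : ∀ R > (0:ℝ), ∃ K > (0:ℝ), ∀ p q ω, |p| ≤ R → |q| ≤ R →
      |H p 0 ω - H q 0 ω| ≤ K * |p - q|
  H_mod : ∀ R > (0:ℝ), ∃ m : ℝ → ℝ, (∀ r, 0 ≤ m r) ∧ MonotoneOn m (Ici 0) ∧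
      Tendsto m (nhdsWithin 0 (Ioi 0)) (nhds 0) ∧
      ∀ p x ω, |p| ≤ R → |H p x ω - H p 0 ω| ≤ m |x|

/-- `f` is a stationary solution of `a(x,ω) f' + H(f,x,ω) = lam`. -/
def StatSol {Ω : Type} [MeasurableSpace Ω] (P : Measure Ω) (τ : ℝ → Ω → Ω)
    (a : ℝ → Ω → ℝ) (H : ℝ → ℝ → Ω → ℝ) (lam : ℝ) (f : ℝ → Ω → ℝ) : Prop :=
  (Measurable fun q : ℝ × Ω => f q.1 q.2) ∧
  (∀ x ω, f x ω = f 0 (τ x ω)) ∧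
  (∀ ω, ContDiff ℝ 1 fun x => f x ω) ∧
  (∀ᵐ ω ∂P, (∃ M, ∀ x, |f x ω| ≤ M) ∧
    ∀ x, a x ω * deriv (fun y => f y ω) x + H (f x ω) x ω = lam)

/-- `f` is a stationary lower solution (`< lam`). -/
def StatLower {Ω : Type} [MeasurableSpace Ω] (P : Measure Ω) (τ : ℝ → Ω → Ω)
    (a : ℝ → Ω → ℝ) (H : ℝ → ℝ → Ω → ℝ) (lam : ℝ) (f : ℝ → Ω → ℝ) : Prop :=
  (Measurable fun q : ℝ × Ω => f q.1 q.2) ∧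
  (∀ x ω, f x ω = f 0 (τ x ω)) ∧
  (∀ ω, ContDiff ℝ 1 fun x => f x ω) ∧
  (∀ᵐ ω ∂P, (∃ M, ∀ x, |f x ω| ≤ M) ∧
    ∀ x, a x ω * deriv (fun y => f y ω) x + H (f x ω) x ω < lam)

/-- `f` is a stationary upper solution (`> lam`). -/
def StatUpper {Ω : Type} [MeasurableSpace Ω] (P : Measure Ω) (τ : ℝ → Ω → Ω)
    (a : ℝ → Ω → ℝ) (H : ℝ → ℝ → Ω → ℝ) (lam : ℝ) (f : ℝ → Ω → ℝ) : Prop :=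
  (Measurable fun q : ℝ × Ω => f q.1 q.2) ∧
  (∀ x ω, f x ω = f 0 (τ x ω)) ∧
  (∀ ω, ContDiff ℝ 1 fun x => f x ω) ∧
  (∀ᵐ ω ∂P, (∃ M, ∀ x, |f x ω| ≤ M) ∧
    ∀ x, lam < a x ω * deriv (fun y => f y ω) x + H (f x ω) x ω)

/-- The set `S^lam(g₁,g₂,ω)` of C¹ solutions of the ODE in the environment `ω`
that are sandwiched between `g₁` and `g₂`. -/
def SsolOm {Ω : Type} (a : ℝ → Ω → ℝ) (H : ℝ → ℝ → Ω → ℝ) (ω : Ω) (lam : ℝ)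
    (g₁ g₂ : ℝ → ℝ) : Set (ℝ → ℝ) :=
  {f | ContDiff ℝ 1 f ∧ (∀ x, a x ω * deriv f x + H (f x) x ω = lam) ∧
       ∀ x, g₁ x ≤ f x ∧ f x ≤ g₂ x}

/-! ### Scalar ODEs on compact intervals -/

/-- `g` solves `g' = Φ(x, g)` on `[a, b]`. -/
def SolvesOn (Φ : ℝ → ℝ → ℝ) (g : ℝ → ℝ) (a b : ℝ) : Prop :=
  ∀ x ∈ Icc a b, HasDerivWithinAt g (Φ x (g x)) (Icc a b) x

namespace SolvesOn

variable {Φ : ℝ → ℝ → ℝ} {g h : ℝ → ℝ} {a b : ℝ}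

theorem continuousOn (hg : SolvesOn Φ g a b) : ContinuousOn g (Icc a b) :=
  fun x hx => (hg x hx).continuousWithinAt

theorem mono (hg : SolvesOn Φ g a b) {c d : ℝ} (hsub : Icc c d ⊆ Icc a b) : SolvesOn Φ g c d :=
  fun x hx => (hg x (hsub hx)).mono hsub

theorem hasDerivWithinAt_Ici (hg : SolvesOn Φ g a b) {x : ℝ} (hx : x ∈ Ico a b) :
    HasDerivWithinAt g (Φ x (g x)) (Ici x) x :=
  (hg x (Ico_subset_Icc_self hx)).mono_of_mem_nhdsWithin (Icc_mem_nhdsGE_of_mem hx)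

theorem comp_continuousOn (hΦ : Continuous (Function.uncurry Φ)) (hg : ContinuousOn g (Icc a b)) :
    ContinuousOn (fun s => Φ s (g s)) (Icc a b) :=
  hΦ.comp_continuousOn (continuousOn_id.prodMk hg)

theorem intervalIntegrable (hΦ : Continuous (Function.uncurry Φ))
    (hg : ContinuousOn g (Icc a b)) {x : ℝ} (hx : x ∈ Icc a b) :
    IntervalIntegrable (fun s => Φ s (g s)) volume a x := by
  apply ContinuousOn.intervalIntegrable
  rw [uIcc_of_le hx.1]
  exact (comp_continuousOn hΦ hg).mono (Icc_subset_Icc_right hx.2)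

theorem eq_add_integral (hΦ : Continuous (Function.uncurry Φ)) (hg : SolvesOn Φ g a b) {x : ℝ}
    (hx : x ∈ Icc a b) : g x = g a + ∫ s in a..x, Φ s (g s) := by
  rw [intervalIntegral.integral_eq_sub_of_hasDerivAt_of_le hx.1
    (hg.continuousOn.mono (Icc_subset_Icc_right hx.2)) (fun y hy => ?_)
    (intervalIntegrable hΦ hg.continuousOn hx)]
  · ring
  · have hy' : y ∈ Ioo a b := ⟨hy.1, hy.2.trans_le hx.2⟩
    exact (hg y (Ioo_subset_Icc_self hy')).hasDerivAt (Icc_mem_nhds hy'.1 hy'.2)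

/-- A solution starting below a strict supersolution stays below it. -/
theorem le_of_super (hg : SolvesOn Φ g a b) {B B' : ℝ → ℝ} (hB : ∀ x, HasDerivAt B (B' x) x)
    (hlt : ∀ x, Φ x (B x) < B' x) (hab : g a ≤ B a) : ∀ x ∈ Icc a b, g x ≤ B x :=
  image_le_of_deriv_right_lt_deriv_boundary hg.continuousOn
    (fun _ hx => hg.hasDerivWithinAt_Ici hx) hab hB (fun x _ hx => hx ▸ hlt x)

/-- A solution starting above a strict subsolution stays above it. -/
theorem ge_of_sub (hg : SolvesOn Φ g a b) {B B' : ℝ → ℝ} (hB : ∀ x, HasDerivAt B (B' x) x)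
    (hlt : ∀ x, B' x < Φ x (B x)) (hab : B a ≤ g a) : ∀ x ∈ Icc a b, B x ≤ g x := by
  have hneg : SolvesOn (fun x p => -Φ x (-p)) (fun x => -g x) a b := fun x hx => by
    have := (hg x hx).fun_neg
    simpa only [neg_neg] using this
  intro x hx
  have := hneg.le_of_super (B := fun x => -B x) (B' := fun x => -B' x) (fun x => (hB x).neg)
    (fun x => by simpa using hlt x) (by simpa using hab) x hx
  simpa using this

/-- Comparison of two solutions of an ODE with Lipschitz right-hand side. -/
theorem le_of_le (hg : SolvesOn Φ g a b) (hh : SolvesOn Φ h a b) {K : ℝ}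
    (hlip : ∀ x ∈ Icc a b, ∀ p q, |Φ x p - Φ x q| ≤ K * |p - q|) (hab : h a ≤ g a) :
    ∀ x ∈ Icc a b, h x ≤ g x := by
  intro x hx
  have key : ∀ ε > 0, h x ≤ g x + ε * Real.exp ((K + 1) * (x - a)) := by
    intro ε hε
    have hexp : ∀ y, HasDerivAt (fun y => ε * Real.exp ((K + 1) * (y - a)))
        ((K + 1) * (ε * Real.exp ((K + 1) * (y - a)))) y := by
      intro y
      have h1 : HasDerivAt (fun y => (K + 1) * (y - a)) (K + 1) y := by
        simpa using ((hasDerivAt_id y).sub_const a).const_mul (K + 1)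
      exact (h1.exp.const_mul ε).congr_deriv (by ring)
    refine image_le_of_deriv_right_lt_deriv_boundary' hh.continuousOn
      (fun _ hx => hh.hasDerivWithinAt_Ici hx)
      (B := fun y => g y + ε * Real.exp ((K + 1) * (y - a)))
      (B' := fun y => Φ y (g y) + (K + 1) * (ε * Real.exp ((K + 1) * (y - a)))) ?_ ?_ ?_ ?_ hx
    · simpa using hab.trans (by linarith)
    · exact hg.continuousOn.add fun y _ => (hexp y).continuousAt.continuousWithinAt
    · exact fun y hy => (hg.hasDerivWithinAt_Ici hy).add (hexp y).hasDerivWithinAt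
    · intro y hy heq
      have hpos : 0 < ε * Real.exp ((K + 1) * (y - a)) := by positivity
      have h1 := (abs_le.1 (hlip y (Ico_subset_Icc_self hy) (h y) (g y))).2
      rw [heq, add_sub_cancel_left, abs_of_pos hpos] at h1
      rw [heq]
      linarith
  have hlim : Tendsto (fun ε : ℝ => g x + ε * Real.exp ((K + 1) * (x - a))) (nhdsWithin 0 (Ioi 0))
      (nhds (g x)) := by
    have : Continuous fun ε : ℝ => g x + ε * Real.exp ((K + 1) * (x - a)) := by fun_prop
    simpa using (this.tendsto 0).mono_left nhdsWithin_le_nhds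
  exact ge_of_tendsto hlim (eventually_nhdsWithin_of_forall key)

end SolvesOn

/-- Global existence on a compact interval for a bounded, Lipschitz right-hand side. -/
theorem exists_solvesOn {Φ : ℝ → ℝ → ℝ} {a b K C : ℝ} (hab : a ≤ b)
    (hΦ : Continuous (Function.uncurry Φ))
    (hK : 0 < K) (hlip : ∀ x ∈ Icc a b, ∀ p q, |Φ x p - Φ x q| ≤ K * |p - q|)
    (hC : ∀ x ∈ Icc a b, ∀ p, |Φ x p| ≤ C) (y₀ : ℝ) :
    ∃ g, g a = y₀ ∧ SolvesOn Φ g a b := by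
  have hC0 : 0 ≤ C := (abs_nonneg _).trans (hC a (left_mem_Icc.2 hab) 0)
  have hpl : IsPicardLindelof Φ (⟨a, left_mem_Icc.2 hab⟩ : Icc a b) y₀
      (Real.toNNReal (C * (b - a))) 0 (Real.toNNReal C) (Real.toNNReal K) := by
    refine ⟨fun t ht => ?_, fun x _ => ?_, fun t ht x _ => ?_, ?_⟩
    · refine LipschitzOnWith.of_dist_le_mul fun p _ q _ => ?_
      simpa [Real.dist_eq, hK.le] using hlip t ht p q
    · exact (hΦ.comp (continuous_id.prodMk continuous_const)).continuousOn
    · simpa [hC0] using hC t ht x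
    · have : 0 ≤ b - a := sub_nonneg.2 hab
      simp [hC0, this, mul_nonneg]
  exact hpl.exists_eq_forall_mem_Icc_hasDerivWithinAt₀

/-- Picard iterates for `g' = Φ(x, g)`, `g a = y₀`. -/
noncomputable def picard (Φ : ℝ → ℝ → ℝ) (a y₀ : ℝ) : ℕ → ℝ → ℝ
  | 0 => fun _ => y₀
  | k + 1 => fun x => y₀ + ∫ s in a..x, Φ s (picard Φ a y₀ k s)

theorem continuous_picard {Φ : ℝ → ℝ → ℝ} (hΦ : Continuous (Function.uncurry Φ)) (a y₀ : ℝ)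
    (k : ℕ) : Continuous (picard Φ a y₀ k) := by
  induction k with
  | zero => exact continuous_const
  | succ k ih =>
    have : Continuous fun s => Φ s (picard Φ a y₀ k s) := hΦ.comp (continuous_id.prodMk ih)
    exact continuous_const.add
      (intervalIntegral.continuous_primitive (fun c d => this.intervalIntegrable c d) a)

theorem SolvesOn.tendsto_picard {Φ : ℝ → ℝ → ℝ} {g : ℝ → ℝ} {a b K : ℝ} (hg : SolvesOn Φ g a b)
    (hΦ : Continuous (Function.uncurry Φ))
    (hK : 0 < K) (hlip : ∀ x ∈ Icc a b, ∀ p q, |Φ x p - Φ x q| ≤ K * |p - q|)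
    {x : ℝ} (hx : x ∈ Icc a b) :
    Tendsto (fun k => picard Φ a (g a) k x) atTop (nhds (g x)) := by
  obtain ⟨M, hM⟩ := isCompact_Icc.exists_bound_of_continuousOn
    (hg.continuousOn.sub continuousOn_const : ContinuousOn (fun x => g x - g a) (Icc a b))
  have hM0 : 0 ≤ M := (norm_nonneg _).trans (hM x hx)
  have key : ∀ k : ℕ, ∀ x ∈ Icc a b,
      |picard Φ a (g a) k x - g x| ≤ M * (1 / 2) ^ k * Real.exp (2 * K * (x - a)) := by
    intro k
    induction k with
    | zero =>
      intro x hx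
      have h1 : 1 ≤ Real.exp (2 * K * (x - a)) :=
        Real.one_le_exp (mul_nonneg (by positivity) (sub_nonneg.2 hx.1))
      have h2 : ‖g x - g a‖ ≤ M := hM x hx
      rw [Real.norm_eq_abs, abs_sub_comm] at h2
      simpa [picard] using h2.trans (le_mul_of_one_le_right hM0 h1)
    | succ k ih =>
      intro x hx
      have hpc := continuous_picard hΦ a (g a) k
      have hint : ∫ s in a..x, K * (M * (1 / 2) ^ k * Real.exp (2 * K * (s - a)))
          = M * (1 / 2) ^ (k + 1) * Real.exp (2 * K * (x - a)) - M * (1 / 2) ^ (k + 1) := by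
        have hd : ∀ s, HasDerivAt (fun s => M * (1 / 2) ^ (k + 1) * Real.exp (2 * K * (s - a)))
            (K * (M * (1 / 2) ^ k * Real.exp (2 * K * (s - a)))) s := by
          intro s
          have h1 : HasDerivAt (fun s => 2 * K * (s - a)) (2 * K) s := by
            simpa using ((hasDerivAt_id s).sub_const a).const_mul (2 * K)
          exact (h1.exp.const_mul (M * (1 / 2) ^ (k + 1))).congr_deriv (by ring)
        rw [intervalIntegral.integral_eq_sub_of_hasDerivAt (fun s _ => hd s)
          (Continuous.intervalIntegrable (by fun_prop) _ _)]
        simp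
      have hle : |∫ s in a..x, (Φ s (picard Φ a (g a) k s) - Φ s (g s))|
          ≤ ∫ s in a..x, K * (M * (1 / 2) ^ k * Real.exp (2 * K * (s - a))) := by
        have hcont : Continuous fun s => K * (M * (1 / 2) ^ k * Real.exp (2 * K * (s - a))) := by
          fun_prop
        rw [← Real.norm_eq_abs]
        refine intervalIntegral.norm_integral_le_of_norm_le hx.1
          (Eventually.of_forall fun s hs => ?_) (hcont.intervalIntegrable (μ := volume) a x)
        have hs' : s ∈ Icc a b := ⟨hs.1.le, hs.2.trans hx.2⟩
        exact (hlip s hs' _ _).trans (mul_le_mul_of_nonneg_left (ih s hs') hK.le)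
      have heq : picard Φ a (g a) (k + 1) x - g x
          = ∫ s in a..x, (Φ s (picard Φ a (g a) k s) - Φ s (g s)) := by
        rw [intervalIntegral.integral_sub
          (SolvesOn.intervalIntegrable hΦ hpc.continuousOn hx)
          (SolvesOn.intervalIntegrable hΦ hg.continuousOn hx), hg.eq_add_integral hΦ hx]
        simp only [picard]
        ring
      rw [heq]
      refine (hle.trans hint.le).trans (sub_le_self _ (by positivity))
  rw [tendsto_iff_norm_sub_tendsto_zero]
  refine squeeze_zero (fun _ => norm_nonneg _) (fun k => key k x hx) ?_
  have := (tendsto_pow_atTop_nhds_zero_of_lt_one (r := (1 / 2 : ℝ)) (by norm_num)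
    (by norm_num)).const_mul M |>.mul_const (Real.exp (2 * K * (x - a)))
  simpa using this

theorem measurable_intervalIntegral_param {Ω : Type*} [MeasurableSpace Ω] {ψ : ℝ → Ω → ℝ}
    (hψ : Measurable (Function.uncurry ψ)) (a : ℝ) :
    Measurable fun q : ℝ × Ω => ∫ s in a..q.1, ψ s q.2 := by
  have key : ∀ S : ℝ → Set ℝ, (∀ x, MeasurableSet (S x)) → MeasurableSet {z : ℝ × ℝ | z.2 ∈ S z.1} →
      Measurable fun q : ℝ × Ω => ∫ s in S q.1, ψ s q.2 := by
    intro S hS hS'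
    simp_rw [← integral_indicator (hS _)]
    refine (StronglyMeasurable.integral_prod_right (ν := volume)
      (f := fun (q : ℝ × Ω) s => (S q.1).indicator (fun s => ψ s q.2) s) ?_).measurable
    have hT : MeasurableSet {z : (ℝ × Ω) × ℝ | z.2 ∈ S z.1.1} :=
      hS'.preimage (f := fun z : (ℝ × Ω) × ℝ => (z.1.1, z.2)) (by fun_prop)
    have hf : Measurable fun z : (ℝ × Ω) × ℝ => ψ z.2 z.1.2 :=
      hψ.comp (f := fun z : (ℝ × Ω) × ℝ => (z.2, z.1.2)) (by fun_prop)
    exact (hf.indicator hT).stronglyMeasurable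
  refine Measurable.sub (key (fun x => Ioc a x) (fun _ => measurableSet_Ioc) ?_)
    (key (fun x => Ioc x a) (fun _ => measurableSet_Ioc) ?_)
  · exact (measurableSet_lt measurable_const measurable_snd).inter
      (measurableSet_le measurable_snd measurable_fst)
  · exact (measurableSet_lt measurable_fst measurable_snd).inter
      (measurableSet_le measurable_snd measurable_const)

theorem measurable_picard {Ω : Type*} [MeasurableSpace Ω] {Φ : ℝ → ℝ → Ω → ℝ} {y₀ : Ω → ℝ}
    (hΦ : Measurable fun q : ℝ × ℝ × Ω => Φ q.1 q.2.1 q.2.2) (hy₀ : Measurable y₀) (a : ℝ)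
    (k : ℕ) :
    Measurable fun q : ℝ × Ω => picard (fun x p => Φ x p q.2) a (y₀ q.2) k q.1 := by
  induction k with
  | zero => exact hy₀.comp measurable_snd
  | succ k ih =>
    refine (hy₀.comp measurable_snd).add (measurable_intervalIntegral_param
      (ψ := fun s ω => Φ s (picard (fun x p => Φ x p ω) a (y₀ ω) k s) ω) ?_ a)
    exact hΦ.comp (measurable_fst.prodMk (ih.prodMk measurable_snd))

/-! ### Maximal solutions between two barriers -/

/-- `b₁ < b₂` are a strict subsolution and a strict supersolution of `g' = F(x, g)`. -/
structure IsBarrierPair (F : ℝ → ℝ → ℝ) (b₁ b₂ : ℝ → ℝ) : Prop where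
  cont : Continuous (Function.uncurry F)
  lip : ∀ R > 0, ∃ K > 0, ∀ x p q, |x| ≤ R → |p| ≤ R → |q| ≤ R → |F x p - F x q| ≤ K * |p - q|
  lt : ∀ x, b₁ x < b₂ x
  diff₁ : Differentiable ℝ b₁
  diff₂ : Differentiable ℝ b₂
  sub : ∀ x, deriv b₁ x < F x (b₁ x)
  super : ∀ x, F x (b₂ x) < deriv b₂ x

/-- Global solutions of `g' = F(x, g)` between `b₁` and `b₂`. -/
def solutionsBetween (F : ℝ → ℝ → ℝ) (b₁ b₂ : ℝ → ℝ) : Set (ℝ → ℝ) :=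
  {g | (∀ x, HasDerivAt g (F x (g x)) x) ∧ ∀ x, b₁ x ≤ g x ∧ g x ≤ b₂ x}

/-- The field `F` with its state variable clipped to `[b₁ x, b₂ x]`. -/
def clipField (F : ℝ → ℝ → ℝ) (b₁ b₂ : ℝ → ℝ) (x p : ℝ) : ℝ :=
  F x (max (b₁ x) (min p (b₂ x)))

theorem clipField_eq {F : ℝ → ℝ → ℝ} {b₁ b₂ : ℝ → ℝ} {x p : ℝ} (h₁ : b₁ x ≤ p) (h₂ : p ≤ b₂ x) :
    clipField F b₁ b₂ x p = F x p := by
  rw [clipField, min_eq_left h₂, max_eq_right h₁]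

namespace IsBarrierPair

variable {F : ℝ → ℝ → ℝ} {b₁ b₂ : ℝ → ℝ}

theorem continuous_clipField (h : IsBarrierPair F b₁ b₂) :
    Continuous (Function.uncurry (clipField F b₁ b₂)) := by
  have h₁ := h.diff₁.continuous
  have h₂ := h.diff₂.continuous
  exact h.cont.comp (continuous_fst.prodMk ((h₁.comp continuous_fst).max
    (continuous_snd.min (h₂.comp continuous_fst))))

theorem exists_bound (h : IsBarrierPair F b₁ b₂) (n : ℝ) :
    ∃ R > 0, n ≤ R ∧ ∀ x ∈ Icc (-n) n, ∀ p, |max (b₁ x) (min p (b₂ x))| ≤ R := by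
  obtain ⟨M₁, hM₁⟩ := isCompact_Icc.exists_bound_of_continuousOn
    (h.diff₁.continuous.continuousOn (s := Icc (-n) n))
  obtain ⟨M₂, hM₂⟩ := isCompact_Icc.exists_bound_of_continuousOn
    (h.diff₂.continuous.continuousOn (s := Icc (-n) n))
  refine ⟨max 1 (max n (max M₁ M₂)), by positivity, by simp, fun x hx p => ?_⟩
  have h₁ := abs_le.1 (hM₁ x hx)
  have h₂ := abs_le.1 (hM₂ x hx)
  have hlt := h.lt x
  have hle₁ : M₁ ≤ max 1 (max n (max M₁ M₂)) := by simp
  have hle₂ : M₂ ≤ max 1 (max n (max M₁ M₂)) := by simp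
  rw [abs_le]
  constructor
  · exact le_trans (by linarith) (le_max_left _ _)
  · exact max_le (by linarith) ((min_le_right _ _).trans (by linarith))

theorem exists_lipschitz (h : IsBarrierPair F b₁ b₂) (n : ℝ) :
    ∃ K > 0, ∀ x ∈ Icc (-n) n, ∀ p q,
      |clipField F b₁ b₂ x p - clipField F b₁ b₂ x q| ≤ K * |p - q| := by
  obtain ⟨R, hR, hn, hb⟩ := h.exists_bound n
  obtain ⟨K, hK, hlip⟩ := h.lip R hR
  refine ⟨K, hK, fun x hx p q => ?_⟩
  refine (hlip x _ _ ((abs_le.2 hx).trans hn) (hb x hx p) (hb x hx q)).trans ?_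
  refine mul_le_mul_of_nonneg_left ?_ hK.le
  refine (abs_max_sub_max_le_max _ _ _ _).trans ?_
  rw [sub_self, abs_zero, max_eq_right (abs_nonneg _)]
  exact (abs_min_sub_min_le_max _ _ _ _).trans (by simp)

theorem exists_clipField_bound (h : IsBarrierPair F b₁ b₂) (n : ℝ) :
    ∃ C, ∀ x ∈ Icc (-n) n, ∀ p, |clipField F b₁ b₂ x p| ≤ C := by
  obtain ⟨R, hR, hn, hb⟩ := h.exists_bound n
  obtain ⟨C, hC⟩ := (isCompact_Icc.prod isCompact_Icc).exists_bound_of_continuousOn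
    (h.cont.continuousOn (s := Icc (-n) n ×ˢ Icc (-R) R))
  exact ⟨C, fun x hx p => hC (x, _) ⟨hx, abs_le.1 (hb x hx p)⟩⟩

theorem mem_Icc_of_solvesOn (h : IsBarrierPair F b₁ b₂) {g : ℝ → ℝ} {a b : ℝ}
    (hg : SolvesOn (clipField F b₁ b₂) g a b) (ha : g a = b₂ a) :
    ∀ x ∈ Icc a b, b₁ x ≤ g x ∧ g x ≤ b₂ x := by
  intro x hx
  constructor
  · refine hg.ge_of_sub (fun y => (h.diff₁ y).hasDerivAt) (fun y => ?_) (ha ▸ (h.lt a).le) x hx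
    rw [clipField_eq le_rfl (h.lt y).le]
    exact h.sub y
  · refine hg.le_of_super (fun y => (h.diff₂ y).hasDerivAt) (fun y => ?_) ha.le x hx
    rw [clipField_eq (h.lt y).le le_rfl]
    exact h.super y

theorem solvesOn_of_mem {g : ℝ → ℝ} (hg : g ∈ solutionsBetween F b₁ b₂) (a b : ℝ) :
    SolvesOn (clipField F b₁ b₂) g a b := fun x _ => by
  rw [clipField_eq (hg.2 x).1 (hg.2 x).2]
  exact (hg.1 x).hasDerivWithinAt

/-- The maximal solution between the barriers is the decreasing limit of the solutions `g n`
of the clipped equation started from the upper barrier at `-n`. -/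
theorem exists_isGreatest_limit (h : IsBarrierPair F b₁ b₂) {g : ℕ → ℝ → ℝ}
    (hg : ∀ n : ℕ, SolvesOn (clipField F b₁ b₂) (g n) (-n) n)
    (hg₀ : ∀ n : ℕ, g n (-n) = b₂ (-n)) :
    ∃ G, IsGreatest (solutionsBetween F b₁ b₂) G ∧
      ∀ x, Tendsto (fun n : ℕ => g (n + ⌈|x|⌉₊) x) atTop (nhds (G x)) := by
  have hIcc : ∀ {m n : ℕ}, m ≤ n → Icc (-m : ℝ) m ⊆ Icc (-n : ℝ) n := fun hmn =>
    Icc_subset_Icc (neg_le_neg (Nat.cast_le.2 hmn)) (Nat.cast_le.2 hmn)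
  have hbd : ∀ n : ℕ, ∀ x ∈ Icc (-n : ℝ) n, b₁ x ≤ g n x ∧ g n x ≤ b₂ x := fun n =>
    h.mem_Icc_of_solvesOn (hg n) (hg₀ n)
  have hanti : ∀ n : ℕ, ∀ x ∈ Icc (-n : ℝ) n, g (n + 1) x ≤ g n x := by
    intro n
    obtain ⟨K, -, hlip⟩ := h.exists_lipschitz n
    refine (hg n).le_of_le ((hg (n + 1)).mono (hIcc n.le_succ)) hlip ?_
    rw [hg₀]
    exact (hbd (n + 1) _ (hIcc n.le_succ ⟨le_rfl, by simp⟩)).2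
  have hmemceil : ∀ (x : ℝ) (n : ℕ), x ∈ Icc (-(n + ⌈|x|⌉₊ : ℕ) : ℝ) (n + ⌈|x|⌉₊ : ℕ) := by
    intro x n
    refine hIcc (Nat.le_add_left _ n) (abs_le.1 (Nat.le_ceil |x|))
  have hlim : ∀ x, Tendsto (fun n : ℕ => g (n + ⌈|x|⌉₊) x) atTop
      (nhds (⨅ n : ℕ, g (n + ⌈|x|⌉₊) x)) := by
    intro x
    refine tendsto_atTop_ciInf (antitone_nat_of_succ_le fun n => ?_) ⟨b₁ x, ?_⟩
    · rw [Nat.add_right_comm]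
      exact hanti _ x (hmemceil x n)
    · rintro _ ⟨n, rfl⟩
      exact (hbd _ x (hmemceil x n)).1
  set G : ℝ → ℝ := fun x => ⨅ n : ℕ, g (n + ⌈|x|⌉₊) x with hG
  have hlim' : ∀ x, Tendsto (fun n : ℕ => g n x) atTop (nhds (G x)) := fun x =>
    (tendsto_add_atTop_iff_nat (f := fun n => g n x) _).1 (hlim x)
  have hGbd : ∀ x, b₁ x ≤ G x ∧ G x ≤ b₂ x := fun x =>
    ⟨ge_of_tendsto' (hlim x) fun n => (hbd _ x (hmemceil x n)).1,
      le_of_tendsto' (hlim x) fun n => (hbd _ x (hmemceil x n)).2⟩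
  have hΦ := h.continuous_clipField
  have hGcontOn : ∀ m : ℕ, ContinuousOn G (Icc (-m : ℝ) m) := by
    intro m
    obtain ⟨C, hC⟩ := h.exists_clipField_bound m
    refine LipschitzOnWith.continuousOn (K := C.toNNReal) ?_
    refine LipschitzOnWith.of_dist_le_mul fun x hx y hy => ?_
    have hC0 : 0 ≤ C := (abs_nonneg _).trans (hC x hx 0)
    rw [Real.coe_toNNReal _ hC0, dist_comm x y, dist_comm (G x)]
    refine le_of_tendsto ((hlim' y).dist (hlim' x)) ?_
    filter_upwards [eventually_ge_atTop m] with n hn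
    exact (convex_Icc _ _).norm_image_sub_le_of_norm_hasDerivWithin_le
      ((hg n).mono (hIcc hn)) (fun z hz => hC z hz _) hx hy
  have hGcont : Continuous G := by
    rw [continuous_iff_continuousAt]
    intro x
    refine (hGcontOn (⌈|x|⌉₊ + 1)).continuousAt (Icc_mem_nhds ?_ ?_) <;>
    · have := abs_le.1 (Nat.le_ceil |x|)
      push_cast
      linarith
  have hΦG : Continuous fun s => clipField F b₁ b₂ s (G s) :=
    hΦ.comp (continuous_id.prodMk hGcont)
  have hGint : ∀ m : ℕ, ∀ x ∈ Icc (-m : ℝ) m,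
      G x = G (-m) + ∫ s in (-m : ℝ)..x, clipField F b₁ b₂ s (G s) := by
    intro m x hx
    obtain ⟨C, hC⟩ := h.exists_clipField_bound m
    have hsub : uIoc (-m : ℝ) x ⊆ Icc (-m : ℝ) m := by
      rw [uIoc_of_le hx.1]
      exact Ioc_subset_Icc_self.trans (Icc_subset_Icc_right hx.2)
    have hI : Tendsto (fun n : ℕ => ∫ s in (-m : ℝ)..x, clipField F b₁ b₂ s (g n s)) atTop
        (nhds (∫ s in (-m : ℝ)..x, clipField F b₁ b₂ s (G s))) := by
      refine intervalIntegral.tendsto_integral_filter_of_dominated_convergence (fun _ => C)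
        ?_ ?_ intervalIntegrable_const ?_
      · filter_upwards [eventually_ge_atTop m] with n hn
        exact ((SolvesOn.comp_continuousOn hΦ ((hg n).mono (hIcc hn)).continuousOn).mono
          hsub).aestronglyMeasurable measurableSet_uIoc
      · exact Eventually.of_forall fun n => Eventually.of_forall fun s hs => hC s (hsub hs) _
      · refine Eventually.of_forall fun s _ => ?_
        exact (hΦ.tendsto (s, G s)).comp (tendsto_const_nhds.prodMk_nhds (hlim' s))
    refine tendsto_nhds_unique (hlim' x) (((hlim' (-m)).add hI).congr' ?_)
    filter_upwards [eventually_ge_atTop m] with n hn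
    exact (((hg n).mono (hIcc hn)).eq_add_integral hΦ hx).symm
  have hGderiv : ∀ x, HasDerivAt G (F x (G x)) x := by
    intro x
    have hm := abs_le.1 (Nat.le_ceil |x|)
    have hd := ((hΦG.integral_hasStrictDerivAt (-((⌈|x|⌉₊ + 1 : ℕ) : ℝ)) x).hasDerivAt).const_add
      (G (-((⌈|x|⌉₊ + 1 : ℕ) : ℝ)))
    rw [clipField_eq (hGbd x).1 (hGbd x).2] at hd
    refine hd.congr_of_eventuallyEq ?_
    filter_upwards [Icc_mem_nhds (a := -((⌈|x|⌉₊ + 1 : ℕ) : ℝ)) (b := ((⌈|x|⌉₊ + 1 : ℕ) : ℝ))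
      (by push_cast; linarith) (by push_cast; linarith)] with y hy
    exact hGint _ y hy
  refine ⟨G, ⟨⟨hGderiv, hGbd⟩, fun f hf x => ?_⟩, hlim⟩
  refine ge_of_tendsto' (hlim x) fun n => ?_
  obtain ⟨K, -, hlip⟩ := h.exists_lipschitz (n + ⌈|x|⌉₊ : ℕ)
  refine (hg _).le_of_le (solvesOn_of_mem hf _ _) hlip ?_ x (hmemceil x n)
  rw [hg₀]
  exact (hf.2 _).2

end IsBarrierPair

/-- The maximal solution between two barriers depends measurably on parameters. -/
theorem exists_measurable_isGreatest {Ω : Type*} [MeasurableSpace Ω] {F : ℝ → ℝ → Ω → ℝ}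
    {b₁ b₂ : ℝ → Ω → ℝ} (hF : Measurable fun q : ℝ × ℝ × Ω => F q.1 q.2.1 q.2.2)
    (hb₁ : Measurable fun q : ℝ × Ω => b₁ q.1 q.2) (hb₂ : Measurable fun q : ℝ × Ω => b₂ q.1 q.2)
    (h : ∀ ω, IsBarrierPair (fun x p => F x p ω) (fun x => b₁ x ω) (fun x => b₂ x ω)) :
    ∃ G : ℝ → Ω → ℝ, (∀ x, Measurable (G x)) ∧
      ∀ ω, IsGreatest (solutionsBetween (fun x p => F x p ω) (fun x => b₁ x ω) (fun x => b₂ x ω))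
        (fun x => G x ω) := by
  have hex : ∀ (ω : Ω) (n : ℕ), ∃ g : ℝ → ℝ, g (-n) = b₂ (-n) ω ∧ SolvesOn
      (clipField (fun x p => F x p ω) (fun x => b₁ x ω) (fun x => b₂ x ω)) g (-n) n := by
    intro ω n
    obtain ⟨K, hK, hlip⟩ := (h ω).exists_lipschitz n
    obtain ⟨C, hC⟩ := (h ω).exists_clipField_bound n
    exact exists_solvesOn (by linarith [n.cast_nonneg (α := ℝ)]) (h ω).continuous_clipField hK hlip
      hC _
  choose g hg₀ hg using hex
  have hmeas : ∀ n : ℕ, ∀ x ∈ Icc (-n : ℝ) n, Measurable fun ω => g ω n x := by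
    intro n x hx
    refine measurable_of_tendsto_metrizable (f := fun k ω => picard
      (clipField (fun x p => F x p ω) (fun x => b₁ x ω) (fun x => b₂ x ω)) (-n) (b₂ (-n) ω) k x)
      (fun k => ?_) (tendsto_pi_nhds.2 fun ω => ?_)
    · refine (measurable_picard (Φ := fun x p ω => clipField (fun x p => F x p ω)
        (fun x => b₁ x ω) (fun x => b₂ x ω) x p) (y₀ := fun ω => b₂ (-n) ω) ?_ ?_ (-n) k).comp
        measurable_prodMk_left
      · have hxω : Measurable fun q : ℝ × ℝ × Ω => (q.1, q.2.2) := by fun_prop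
        exact hF.comp (measurable_fst.prodMk (((hb₁.comp hxω).max
          ((measurable_fst.comp measurable_snd).min (hb₂.comp hxω))).prodMk
          (measurable_snd.comp measurable_snd)))
      · exact hb₂.comp measurable_prodMk_left
    · obtain ⟨K, hK, hlip⟩ := (h ω).exists_lipschitz n
      rw [← hg₀ ω n]
      exact (hg ω n).tendsto_picard (h ω).continuous_clipField hK hlip hx
  choose G hG hlim using fun ω => (h ω).exists_isGreatest_limit (hg ω) (hg₀ ω)
  refine ⟨fun x ω => G ω x, fun x => ?_, hG⟩
  refine measurable_of_tendsto_metrizable (fun n => hmeas (n + ⌈|x|⌉₊) x ?_)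
    (tendsto_pi_nhds.2 fun ω => hlim ω x)
  have := abs_le.1 (Nat.le_ceil |x|)
  have hn : (0 : ℝ) ≤ n := n.cast_nonneg
  push_cast
  constructor <;> linarith

/-- The reflection `x ↦ -x` turns `g' = F(x, g)` into `g' = -F(-x, g)`. -/
theorem comp_neg_mem_solutionsBetween {F : ℝ → ℝ → ℝ} {b₁ b₂ g : ℝ → ℝ}
    (hg : g ∈ solutionsBetween F b₁ b₂) :
    (fun x => g (-x)) ∈
      solutionsBetween (fun x p => -F (-x) p) (fun x => b₁ (-x)) (fun x => b₂ (-x)) := by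
  refine ⟨fun x => ?_, fun x => hg.2 (-x)⟩
  exact ((hg.1 (-x)).scomp x (hasDerivAt_neg x)).congr_deriv (by simp)

theorem isGreatest_solutionsBetween_comp_neg {F : ℝ → ℝ → ℝ} {b₁ b₂ g : ℝ → ℝ}
    (hg : IsGreatest
      (solutionsBetween (fun x p => -F (-x) p) (fun x => b₁ (-x)) (fun x => b₂ (-x))) g) :
    IsGreatest (solutionsBetween F b₁ b₂) (fun x => g (-x)) := by
  refine ⟨by simpa using comp_neg_mem_solutionsBetween hg.1, fun f hf x => ?_⟩
  simpa using hg.2 (comp_neg_mem_solutionsBetween hf) (-x)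

theorem comp_add_mem_solutionsBetween {F : ℝ → ℝ → ℝ} {b₁ b₂ g : ℝ → ℝ}
    (hg : g ∈ solutionsBetween F b₁ b₂) (c : ℝ) :
    (fun x => g (x + c)) ∈
      solutionsBetween (fun x p => F (x + c) p) (fun x => b₁ (x + c)) (fun x => b₂ (x + c)) :=
  ⟨fun x => (hg.1 (x + c)).comp_add_const x c, fun x => hg.2 (x + c)⟩

theorem isGreatest_solutionsBetween_comp_add {F : ℝ → ℝ → ℝ} {b₁ b₂ g : ℝ → ℝ}
    (hg : IsGreatest (solutionsBetween F b₁ b₂) g) (c : ℝ) :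
    IsGreatest (solutionsBetween (fun x p => F (x + c) p) (fun x => b₁ (x + c))
      (fun x => b₂ (x + c))) (fun x => g (x + c)) := by
  refine ⟨comp_add_mem_solutionsBetween hg.1 c, fun f hf x => ?_⟩
  have := hg.2 (by simpa using comp_add_mem_solutionsBetween hf (-c)) (x + c)
  simpa using this

/-- `exists_measurable_isGreatest` when the barriers are ordered for the forward or for the
backward equation. -/
theorem exists_measurable_isGreatest_of_or {Ω : Type*} [MeasurableSpace Ω] {F : ℝ → ℝ → Ω → ℝ}
    {b₁ b₂ : ℝ → Ω → ℝ} (hF : Measurable fun q : ℝ × ℝ × Ω => F q.1 q.2.1 q.2.2)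
    (hb₁ : Measurable fun q : ℝ × Ω => b₁ q.1 q.2) (hb₂ : Measurable fun q : ℝ × Ω => b₂ q.1 q.2)
    (h : (∀ ω, IsBarrierPair (fun x p => F x p ω) (fun x => b₁ x ω) (fun x => b₂ x ω)) ∨
      ∀ ω, IsBarrierPair (fun x p => -F (-x) p ω) (fun x => b₁ (-x) ω) (fun x => b₂ (-x) ω)) :
    ∃ G : ℝ → Ω → ℝ, (∀ x, Measurable (G x)) ∧
      ∀ ω, IsGreatest (solutionsBetween (fun x p => F x p ω) (fun x => b₁ x ω) (fun x => b₂ x ω))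
        (fun x => G x ω) := by
  rcases h with h | h
  · exact exists_measurable_isGreatest hF hb₁ hb₂ h
  · have hneg : Measurable fun q : ℝ × Ω => (-q.1, q.2) := by fun_prop
    have hneg' : Measurable fun q : ℝ × ℝ × Ω => (-q.1, q.2.1, q.2.2) := by fun_prop
    obtain ⟨G, hGm, hG⟩ := exists_measurable_isGreatest (F := fun x p ω => -F (-x) p ω)
      (b₁ := fun x => b₁ (-x)) (b₂ := fun x => b₂ (-x))
      (hF.comp hneg').neg (hb₁.comp hneg) (hb₂.comp hneg) h
    exact ⟨fun x => G (-x), fun x => hGm _, fun ω =>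
      isGreatest_solutionsBetween_comp_neg (F := fun x p => F x p ω)
        (b₁ := fun x => b₁ x ω) (b₂ := fun x => b₂ x ω) (g := fun x => G x ω) (hG ω)⟩

/-! ### The stationary ergodic setting -/

namespace HJSetting

variable {Ω : Type} [MeasurableSpace Ω] {P : Measure Ω} {τ : ℝ → Ω → Ω}
  {a : ℝ → Ω → ℝ} {H : ℝ → ℝ → Ω → ℝ} {G_L G_U : ℝ → ℝ}

/-- A shift-stable property that holds almost surely holds on a measurable invariant event of full
measure: the event that it holds for almost every translate in a measurable event implying it. -/
theorem exists_invariant_measurableSet (hset : HJSetting P τ a H G_L G_U) {p : Ω → Prop}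
    (hp : ∀ᵐ ω ∂P, p ω) (hinv : ∀ x ω, p (τ x ω) → p ω) :
    ∃ A, MeasurableSet A ∧ (∀ᵐ ω ∂P, ω ∈ A) ∧ (∀ ω ∈ A, p ω) ∧ ∀ x ω, τ x ω ∈ A ↔ ω ∈ A := by
  have := hset.prob
  obtain ⟨N, hpN, hN, hN0⟩ := exists_measurable_superset_of_null (ae_iff.1 hp)
  have hT : MeasurableSet {z : Ω × ℝ | τ z.2 z.1 ∈ N} :=
    hN.preimage (hset.meas_tau.comp measurable_swap)
  have hT' : MeasurableSet {z : ℝ × Ω | τ z.1 z.2 ∈ N} := hN.preimage hset.meas_tau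
  refine ⟨{ω | volume {x | τ x ω ∈ N} = 0}, ?_, ?_, fun ω hω => ?_, fun x ω => ?_⟩
  · exact measurable_measure_prodMk_left (ν := volume) hT (measurableSet_singleton 0)
  · have h1 : (volume.prod P) {z : ℝ × Ω | τ z.1 z.2 ∈ N} = 0 := by
      rw [Measure.measure_prod_null hT']
      refine Eventually.of_forall fun x => ?_
      exact ((hset.mp_tau x).measure_preimage hN.nullMeasurableSet).trans hN0
    have h2 : (P.prod volume) {z : Ω × ℝ | τ z.2 z.1 ∈ N} = 0 := by
      rw [← Measure.prod_swap, Measure.map_apply measurable_swap hT]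
      exact h1
    exact (Measure.measure_prod_null hT).1 h2
  · have hne : ∃ x, τ x ω ∉ N := by
      by_contra! hall
      have huniv : {x | τ x ω ∈ N} = univ := eq_univ_of_forall hall
      have h0 : volume {x | τ x ω ∈ N} = 0 := hω
      simp [huniv] at h0
    obtain ⟨x, hx⟩ := hne
    exact hinv x ω (by_contra fun hnp => hx (hpN hnp))
  · have heq : {y | τ y (τ x ω) ∈ N} = (fun y => y + x) ⁻¹' {y | τ y ω ∈ N} := by
      ext y
      simp [hset.tau_add]
    simp only [mem_ofPred_eq]
    rw [heq, measure_preimage_add_right]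

theorem a_add (hset : HJSetting P τ a H G_L G_U) (x c : ℝ) (ω : Ω) :
    a x (τ c ω) = a (x + c) ω := by
  rw [hset.a_stat, hset.a_stat (x + c), hset.tau_add]

theorem H_add (hset : HJSetting P τ a H G_L G_U) (p x c : ℝ) (ω : Ω) :
    H p x (τ c ω) = H p (x + c) ω := by
  rw [hset.H_stat, hset.H_stat p (x + c), hset.tau_add]

theorem continuous_a (hset : HJSetting P τ a H G_L G_U) (ω : Ω) : Continuous fun x => a x ω := by
  obtain ⟨κ, hκ, hlip⟩ := hset.a_sqrt_lip
  have hsqrt : Continuous fun x => Real.sqrt (a x ω) := by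
    refine LipschitzWith.continuous (K := κ.toNNReal) (LipschitzWith.of_dist_le_mul fun x y => ?_)
    rw [Real.dist_eq, Real.dist_eq, Real.coe_toNNReal _ hκ.le]
    simpa [hset.a_add] using hlip (x - y) (τ y ω)
  refine (hsqrt.pow 2).congr fun x => Real.sq_sqrt (hset.a_pos x ω).le

theorem H_lip_add (hset : HJSetting P τ a H G_L G_U) {R : ℝ} (hR : 0 < R) :
    ∃ K > (0 : ℝ), ∀ p q x ω, |p| ≤ R → |q| ≤ R → |H p x ω - H q x ω| ≤ K * |p - q| := by
  obtain ⟨K, hK, hlip⟩ := hset.H_lip R hR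
  refine ⟨K, hK, fun p q x ω hp hq => ?_⟩
  simpa [hset.H_add] using hlip p q (τ x ω) hp hq

theorem continuous_H (hset : HJSetting P τ a H G_L G_U) (ω : Ω) :
    Continuous fun z : ℝ × ℝ => H z.2 z.1 ω := by
  rw [continuous_iff_continuousAt]
  rintro ⟨x₀, p₀⟩
  have hR : 0 < |p₀| + 1 := by positivity
  obtain ⟨K, hK, hlip⟩ := hset.H_lip_add hR
  obtain ⟨m, hm0, -, hm, hmod⟩ := hset.H_mod _ hR
  have hx : Tendsto (fun x => H p₀ x ω) (nhds x₀) (nhds (H p₀ x₀ ω)) := by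
    rw [Metric.tendsto_nhds]
    intro ε hε
    have h1 : ∀ᶠ r in nhdsWithin 0 (Ioi 0), m r < ε := hm.eventually_lt_const hε
    obtain ⟨δ, hδ, hδm⟩ := mem_nhdsGT_iff_exists_Ioo_subset.1 h1
    filter_upwards [Metric.ball_mem_nhds x₀ hδ] with x hxδ
    rw [Metric.mem_ball, Real.dist_eq] at hxδ
    rcases eq_or_ne x x₀ with rfl | hne
    · simpa using hε
    · rw [Real.dist_eq]
      have h2 := hmod p₀ (x - x₀) (τ x₀ ω) (by linarith)
      rw [hset.H_add, hset.H_add, sub_add_cancel, zero_add] at h2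
      exact h2.trans_lt (hδm ⟨abs_pos.2 (sub_ne_zero.2 hne), hxδ⟩)
  have hp : Tendsto (fun z : ℝ × ℝ => H z.2 z.1 ω - H p₀ z.1 ω) (nhds (x₀, p₀)) (nhds 0) := by
    have hK0 : Tendsto (fun z : ℝ × ℝ => K * |z.2 - p₀|) (nhds (x₀, p₀)) (nhds 0) := by
      have : Continuous fun z : ℝ × ℝ => K * |z.2 - p₀| := by fun_prop
      simpa using this.tendsto (x₀, p₀)
    refine squeeze_zero_norm' ?_ hK0
    have hnear : ∀ᶠ z : ℝ × ℝ in nhds (x₀, p₀), |z.2| < |p₀| + 1 := by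
      have : Continuous fun z : ℝ × ℝ => |z.2| := by fun_prop
      exact this.continuousAt.eventually_lt_const (by simp)
    filter_upwards [hnear] with z hz
    exact hlip _ _ _ _ hz.le (by linarith)
  have := hp.add (hx.comp (continuous_fst.tendsto (x₀, p₀)))
  simpa [ContinuousAt, Function.comp_def] using this

/-- The field `(lam - H) / a` of the equation solved for the derivative. -/
noncomputable def field (a : ℝ → Ω → ℝ) (H : ℝ → ℝ → Ω → ℝ) (lam x p : ℝ) (ω : Ω) : ℝ :=
  (lam - H p x ω) / a x ω

theorem continuous_field (hset : HJSetting P τ a H G_L G_U) (lam : ℝ) (ω : Ω) :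
    Continuous (Function.uncurry fun x p => field a H lam x p ω) :=
  (continuous_const.sub (hset.continuous_H ω)).div ((hset.continuous_a ω).comp continuous_fst)
    fun z => (hset.a_pos z.1 ω).ne'

theorem field_lip (hset : HJSetting P τ a H G_L G_U) (lam : ℝ) (ω : Ω) {R : ℝ} (hR : 0 < R) :
    ∃ K > 0, ∀ x p q, |x| ≤ R → |p| ≤ R → |q| ≤ R →
      |field a H lam x p ω - field a H lam x q ω| ≤ K * |p - q| := by
  obtain ⟨K, hK, hlip⟩ := hset.H_lip_add hR
  obtain ⟨x₀, -, hx₀⟩ := isCompact_Icc.exists_isMinOn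
    (nonempty_Icc.2 (by linarith : -R ≤ R)) (hset.continuous_a ω).continuousOn
  have hpos := hset.a_pos x₀ ω
  refine ⟨K / a x₀ ω, by positivity, fun x p q hx hp hq => ?_⟩
  have hle : a x₀ ω ≤ a x ω := hx₀ (abs_le.1 hx)
  rw [field, field, ← sub_div, abs_div, abs_of_pos (hset.a_pos x ω), div_mul_eq_mul_div]
  refine div_le_div₀ (by positivity) ?_ hpos hle
  rw [sub_sub_sub_cancel_left, abs_sub_comm]
  exact hlip p q x ω hp hq

theorem measurable_field (hset : HJSetting P τ a H G_L G_U) (lam : ℝ) :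
    Measurable fun q : ℝ × ℝ × Ω => field a H lam q.1 q.2.1 q.2.2 := by
  have h1 : Measurable fun q : ℝ × ℝ × Ω => (q.2.1, q.1, q.2.2) := by fun_prop
  have h2 : Measurable fun q : ℝ × ℝ × Ω => (q.1, q.2.2) := by fun_prop
  exact (measurable_const.sub (hset.meas_H.comp h1)).div (hset.meas_a.comp h2)

theorem isBarrierPair_field (hset : HJSetting P τ a H G_L G_U) {lam : ℝ} {ω : Ω} {b₁ b₂ : ℝ → ℝ}
    (hd₁ : Differentiable ℝ b₁) (hd₂ : Differentiable ℝ b₂) (hlt : ∀ x, b₁ x < b₂ x)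
    (h₁ : ∀ x, a x ω * deriv b₁ x + H (b₁ x) x ω < lam)
    (h₂ : ∀ x, lam < a x ω * deriv b₂ x + H (b₂ x) x ω) :
    IsBarrierPair (fun x p => field a H lam x p ω) b₁ b₂ where
  cont := hset.continuous_field lam ω
  lip _ hR := hset.field_lip lam ω hR
  lt := hlt
  diff₁ := hd₁
  diff₂ := hd₂
  sub x := by
    rw [field, lt_div_iff₀ (hset.a_pos x ω)]
    linarith [h₁ x]
  super x := by
    rw [field, div_lt_iff₀ (hset.a_pos x ω)]
    linarith [h₂ x]

theorem isBarrierPair_field_neg (hset : HJSetting P τ a H G_L G_U) {lam : ℝ} {ω : Ω}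
    {b₁ b₂ : ℝ → ℝ}
    (hd₁ : Differentiable ℝ b₁) (hd₂ : Differentiable ℝ b₂) (hlt : ∀ x, b₁ x < b₂ x)
    (h₁ : ∀ x, lam < a x ω * deriv b₁ x + H (b₁ x) x ω)
    (h₂ : ∀ x, a x ω * deriv b₂ x + H (b₂ x) x ω < lam) :
    IsBarrierPair (fun x p => -field a H lam (-x) p ω) (fun x => b₁ (-x)) (fun x => b₂ (-x)) where
  cont := ((hset.continuous_field lam ω).comp (continuous_fst.neg.prodMk continuous_snd)).neg
  lip R hR := by
    obtain ⟨K, hK, hlip⟩ := hset.field_lip lam ω hR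
    refine ⟨K, hK, fun x p q hx hp hq => ?_⟩
    rw [neg_sub_neg, abs_sub_comm]
    exact hlip _ p q (by rwa [abs_neg]) hp hq
  lt x := hlt (-x)
  diff₁ := hd₁.comp differentiable_neg
  diff₂ := hd₂.comp differentiable_neg
  sub x := by
    rw [deriv_comp_neg, neg_lt_neg_iff, field, div_lt_iff₀ (hset.a_pos _ ω)]
    linarith [h₁ (-x)]
  super x := by
    rw [deriv_comp_neg, neg_lt_neg_iff, field, lt_div_iff₀ (hset.a_pos _ ω)]
    linarith [h₂ (-x)]

theorem SsolOm_eq (hset : HJSetting P τ a H G_L G_U) (lam : ℝ) (ω : Ω) (b₁ b₂ : ℝ → ℝ) :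
    SsolOm a H ω lam b₁ b₂ = solutionsBetween (fun x p => field a H lam x p ω) b₁ b₂ := by
  ext f
  constructor
  · rintro ⟨hf, heq, hbd⟩
    refine ⟨fun x => ?_, hbd⟩
    have hderiv : deriv f x = field a H lam x (f x) ω := by
      rw [field, eq_div_iff (hset.a_pos x ω).ne']
      linarith [heq x]
    exact (hf.differentiable one_ne_zero x).hasDerivAt.congr_deriv hderiv
  · rintro ⟨hf, hbd⟩
    have hdiff : Differentiable ℝ f := fun x => (hf x).differentiableAt
    have hderiv : deriv f = fun x => field a H lam x (f x) ω := funext fun x => (hf x).deriv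
    refine ⟨contDiff_one_iff_deriv.2 ⟨hdiff, ?_⟩, fun x => ?_, hbd⟩
    · rw [hderiv]
      exact (hset.continuous_field lam ω).comp (continuous_id.prodMk hdiff.continuous)
    · simp only [hderiv, field]
      rw [mul_div_cancel₀ _ (hset.a_pos x ω).ne']
      ring

/-- A field of maximal solutions between stationary barriers on an invariant event of full measure
yields a stationary solution. -/
theorem exists_statSol_of_isGreatest (hset : HJSetting P τ a H G_L G_U) {lam : ℝ}
    {f₁ f₂ : ℝ → Ω → ℝ} (hs₁ : ∀ x ω, f₁ x ω = f₁ 0 (τ x ω)) (hs₂ : ∀ x ω, f₂ x ω = f₂ 0 (τ x ω))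
    {A : Set Ω} (hA : MeasurableSet A) (hPA : ∀ᵐ ω ∂P, ω ∈ A) (hinv : ∀ x ω, τ x ω ∈ A ↔ ω ∈ A)
    (hbd : ∀ ω ∈ A, ∃ M, ∀ x, |f₁ x ω| ≤ M ∧ |f₂ x ω| ≤ M) {G : ℝ → A → ℝ}
    (hGm : ∀ x, Measurable (G x))
    (hG : ∀ ω : A, IsGreatest (SsolOm a H ω lam (fun x => f₁ x ω) (fun x => f₂ x ω))
      (fun x => G x ω)) :
    ∃ fbar : ℝ → Ω → ℝ, StatSol P τ a H lam fbar ∧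
      ∀ ω ∈ A, IsGreatest (SsolOm a H ω lam (fun x => f₁ x ω) (fun x => f₂ x ω))
        (fun x => fbar x ω) := by
  classical
  set fbar : ℝ → Ω → ℝ := fun x ω => if hω : ω ∈ A then G x ⟨ω, hω⟩ else 0 with hfbar
  have hval : ∀ ω (hω : ω ∈ A), (fun x => fbar x ω) = fun x => G x ⟨ω, hω⟩ := fun ω hω => by
    simp [hfbar, hω]
  have hgreat : ∀ ω ∈ A, IsGreatest (SsolOm a H ω lam (fun x => f₁ x ω) (fun x => f₂ x ω))
      (fun x => fbar x ω) := fun ω hω => hval ω hω ▸ hG ⟨ω, hω⟩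
  have hstat : ∀ x ω, fbar x ω = fbar 0 (τ x ω) := by
    intro c ω
    by_cases hω : ω ∈ A
    · have h1 := hgreat ω hω
      have h2 := hgreat (τ c ω) ((hinv c ω).2 hω)
      rw [hset.SsolOm_eq] at h1 h2
      have h3 := isGreatest_solutionsBetween_comp_add h1 c
      have hf₁ : ∀ x, f₁ x (τ c ω) = f₁ (x + c) ω := fun x => by
        rw [hs₁, hs₁ (x + c), hset.tau_add]
      have hf₂ : ∀ x, f₂ x (τ c ω) = f₂ (x + c) ω := fun x => by
        rw [hs₂, hs₂ (x + c), hset.tau_add]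
      simp only [field, hset.a_add, hset.H_add, hf₁, hf₂] at h2
      have := congrFun (h2.unique h3) 0
      simpa using this.symm
    · simp [hfbar, hω, hinv]
  refine ⟨fbar, ⟨?_, hstat, fun ω => ?_, ?_⟩, hgreat⟩
  · have h0 : Measurable (fbar 0) :=
      Measurable.dite (f := G 0) (g := fun _ => 0) (hGm 0) measurable_const hA
    have heq : (fun q : ℝ × Ω => fbar q.1 q.2) = fun q => fbar 0 (τ q.1 q.2) :=
      funext fun q => hstat q.1 q.2
    exact heq ▸ h0.comp hset.meas_tau
  · by_cases hω : ω ∈ A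
    · exact (hgreat ω hω).1.1
    · simpa [hfbar, hω] using contDiff_const
  · filter_upwards [hPA] with ω hω
    obtain ⟨hmem, -⟩ := hgreat ω hω
    obtain ⟨M, hM⟩ := hbd ω hω
    refine ⟨⟨M, fun x => abs_le.2 ⟨?_, ?_⟩⟩, hmem.2.1⟩
    · exact (abs_le.1 (hM x).1).1.trans (hmem.2.2 x).1
    · exact (hmem.2.2 x).2.trans (abs_le.1 (hM x).2).2

end HJSetting

theorem exists_stationary_solution_between
    {Ω : Type} [MeasurableSpace Ω] (P : Measure Ω) (τ : ℝ → Ω → Ω)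
    (a : ℝ → Ω → ℝ) (H : ℝ → ℝ → Ω → ℝ) (G_L G_U : ℝ → ℝ)
    (hset : HJSetting P τ a H G_L G_U)
    (lam : ℝ) (f₁ f₂ : ℝ → Ω → ℝ)
    (hlt : ∀ᵐ ω ∂P, ∀ x, f₁ x ω < f₂ x ω)
    (hcase : (StatLower P τ a H lam f₁ ∧ StatUpper P τ a H lam f₂) ∨
             (StatUpper P τ a H lam f₁ ∧ StatLower P τ a H lam f₂)) :
    ∃ fbar : ℝ → Ω → ℝ, StatSol P τ a H lam fbar ∧
      ∀ᵐ ω ∂P,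
        (fun x => fbar x ω) ∈ SsolOm a H ω lam (fun x => f₁ x ω) (fun x => f₂ x ω) ∧
        ∀ x, fbar x ω =
          sSup ((fun f : ℝ → ℝ => f x) ''
            SsolOm a H ω lam (fun y => f₁ y ω) (fun y => f₂ y ω)) := by
  have hmeas : (Measurable fun q : ℝ × Ω => f₁ q.1 q.2) ∧ Measurable fun q : ℝ × Ω => f₂ q.1 q.2 := by
    rcases hcase with h | h <;> exact ⟨h.1.1, h.2.1⟩
  have hs₁ : ∀ x ω, f₁ x ω = f₁ 0 (τ x ω) := by
    rcases hcase with h | h <;> exact h.1.2.1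
  have hs₂ : ∀ x ω, f₂ x ω = f₂ 0 (τ x ω) := by
    rcases hcase with h | h <;> exact h.2.2.1
  have hd₁ : ∀ ω, Differentiable ℝ fun x => f₁ x ω := by
    rcases hcase with h | h <;> exact fun ω => (h.1.2.2.1 ω).differentiable one_ne_zero
  have hd₂ : ∀ ω, Differentiable ℝ fun x => f₂ x ω := by
    rcases hcase with h | h <;> exact fun ω => (h.2.2.2.1 ω).differentiable one_ne_zero
  have hadd₁ : ∀ x c ω, f₁ x (τ c ω) = f₁ (x + c) ω := fun x c ω => by
    rw [hs₁, hs₁ (x + c), hset.tau_add]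
  have hadd₂ : ∀ x c ω, f₂ x (τ c ω) = f₂ (x + c) ω := fun x c ω => by
    rw [hs₂, hs₂ (x + c), hset.tau_add]
  have hgood : ∃ A, MeasurableSet A ∧ (∀ᵐ ω ∂P, ω ∈ A) ∧ (∀ x ω, τ x ω ∈ A ↔ ω ∈ A) ∧
      (∀ ω ∈ A, ∃ M, ∀ x, |f₁ x ω| ≤ M ∧ |f₂ x ω| ≤ M) ∧
      ((∀ ω : A, IsBarrierPair (fun x p => HJSetting.field a H lam x p ω)
        (fun x => f₁ x ω) (fun x => f₂ x ω)) ∨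
      ∀ ω : A, IsBarrierPair (fun x p => -HJSetting.field a H lam (-x) p ω)
        (fun x => f₁ (-x) ω) (fun x => f₂ (-x) ω)) := by
    have key : ∀ Q : ℝ → ℝ → Ω → Prop, (∀ M x c ω, Q M x (τ c ω) → Q M (x + c) ω) →
        (∀ᵐ ω ∂P, ∃ M, ∀ x, Q M x ω) →
        ∃ A, MeasurableSet A ∧ (∀ᵐ ω ∂P, ω ∈ A) ∧ (∀ ω ∈ A, ∃ M, ∀ x, Q M x ω) ∧
          ∀ x ω, τ x ω ∈ A ↔ ω ∈ A := by
      intro Q hQ hae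
      refine hset.exists_invariant_measurableSet hae fun c ω ⟨M, hM⟩ => ⟨M, fun x => ?_⟩
      simpa using hQ M (x - c) c ω (hM (x - c))
    rcases hcase with ⟨⟨-, -, -, h₁⟩, -, -, -, h₂⟩ | ⟨⟨-, -, -, h₁⟩, -, -, -, h₂⟩
    · obtain ⟨A, hA, hPA, hgA, hinv⟩ := key
        (fun M x ω => (|f₁ x ω| ≤ M ∧ |f₂ x ω| ≤ M) ∧ f₁ x ω < f₂ x ω ∧
          a x ω * deriv (fun y => f₁ y ω) x + H (f₁ x ω) x ω < lam ∧
          lam < a x ω * deriv (fun y => f₂ y ω) x + H (f₂ x ω) x ω)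
        (fun M x c ω h => by
          simpa only [hset.a_add, hset.H_add, hadd₁, hadd₂,
            deriv_comp_add_const (fun y => f₁ y ω), deriv_comp_add_const (fun y => f₂ y ω)] using h)
        (by
          filter_upwards [hlt, h₁, h₂] with ω hω ⟨⟨M₁, hM₁⟩, hω₁⟩ ⟨⟨M₂, hM₂⟩, hω₂⟩
          exact ⟨max M₁ M₂, fun x => ⟨⟨le_max_of_le_left (hM₁ x), le_max_of_le_right (hM₂ x)⟩,
            hω x, hω₁ x, hω₂ x⟩⟩)
      refine ⟨A, hA, hPA, hinv, fun ω hω => (hgA ω hω).imp fun M hM x => (hM x).1,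
        Or.inl fun ω => ?_⟩
      obtain ⟨M, hM⟩ := hgA ω ω.2
      exact hset.isBarrierPair_field (hd₁ ω) (hd₂ ω) (fun x => (hM x).2.1)
        (fun x => (hM x).2.2.1) (fun x => (hM x).2.2.2)
    · obtain ⟨A, hA, hPA, hgA, hinv⟩ := key
        (fun M x ω => (|f₁ x ω| ≤ M ∧ |f₂ x ω| ≤ M) ∧ f₁ x ω < f₂ x ω ∧
          lam < a x ω * deriv (fun y => f₁ y ω) x + H (f₁ x ω) x ω ∧
          a x ω * deriv (fun y => f₂ y ω) x + H (f₂ x ω) x ω < lam)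
        (fun M x c ω h => by
          simpa only [hset.a_add, hset.H_add, hadd₁, hadd₂,
            deriv_comp_add_const (fun y => f₁ y ω), deriv_comp_add_const (fun y => f₂ y ω)] using h)
        (by
          filter_upwards [hlt, h₁, h₂] with ω hω ⟨⟨M₁, hM₁⟩, hω₁⟩ ⟨⟨M₂, hM₂⟩, hω₂⟩
          exact ⟨max M₁ M₂, fun x => ⟨⟨le_max_of_le_left (hM₁ x), le_max_of_le_right (hM₂ x)⟩,
            hω x, hω₁ x, hω₂ x⟩⟩)
      refine ⟨A, hA, hPA, hinv, fun ω hω => (hgA ω hω).imp fun M hM x => (hM x).1,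
        Or.inr fun ω => ?_⟩
      obtain ⟨M, hM⟩ := hgA ω ω.2
      exact hset.isBarrierPair_field_neg (hd₁ ω) (hd₂ ω) (fun x => (hM x).2.1)
        (fun x => (hM x).2.2.1) (fun x => (hM x).2.2.2)
  obtain ⟨A, hA, hPA, hinv, hbd, hbar⟩ := hgood
  have hcoe : Measurable fun q : ℝ × A => (q.1, (q.2 : Ω)) := by fun_prop
  have hcoe' : Measurable fun q : ℝ × ℝ × A => (q.1, q.2.1, (q.2.2 : Ω)) := by fun_prop
  obtain ⟨G, hGm, hG⟩ := exists_measurable_isGreatest_of_or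
    (F := fun x p (ω : A) => HJSetting.field a H lam x p ω)
    (b₁ := fun x (ω : A) => f₁ x ω) (b₂ := fun x (ω : A) => f₂ x ω)
    ((hset.measurable_field lam).comp hcoe') (hmeas.1.comp hcoe) (hmeas.2.comp hcoe) hbar
  obtain ⟨fbar, hsol, hgreat⟩ := hset.exists_statSol_of_isGreatest (lam := lam) hs₁ hs₂ hA hPA hinv
    hbd hGm fun ω => by
      rw [hset.SsolOm_eq]
      exact hG ω
  refine ⟨fbar, hsol, ?_⟩
  filter_upwards [hPA] with ω hω
  refine ⟨(hgreat ω hω).1, fun x => ?_⟩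
  have hmax : IsGreatest ((fun f : ℝ → ℝ => f x) ''
      SsolOm a H ω lam (fun y => f₁ y ω) (fun y => f₂ y ω)) (fbar x ω) :=
    ⟨⟨_, (hgreat ω hω).1, rfl⟩, by
      rintro _ ⟨f, hf, rfl⟩
      exact (hgreat ω hω).2 hf x⟩
  exact hmax.csSup_eq.symm
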